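/- Let n ≥ 2, let P be a prime divisor of n, write n = P^α m with α = v_P(n) ≥ 1 and gcd(P, m) = 1. If t is an integer with P^{α−1} ∤ t, then the Ramanujan sum c_n(t) = 0. -/

import Mathlib

open Finset

/-- `U n` : the reduced residue system `{a ∈ {1,…,n} : gcd(a,n) = 1}`. -/
def Un (n : ℕ) : Finset ℕ := (Finset.Icc 1 n).filter (fun a => Nat.gcd a n = 1)

/-- The Ramanujan sum `c_n(t) = Σ_{a ∈ U_n} e^{2πiat/n}`. -/
noncomputable def ramanujan (n : ℕ) (t : ℤ) : ℂ :=
  ∑ a ∈ Un n, Complex.exp (2 * Real.pi * Complex.I * a * t / n)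

lemma shift_sum (n : ℕ) (f : ℕ → ℂ) (hf : ∀ a, f (a + n) = f a) (k : ℕ) :
    ∑ i ∈ Finset.range n, f (i + k) = ∑ i ∈ Finset.range n, f i := by
  induction k with
  | zero => simp
  | succ k ih =>
    rw [← ih]
    have h1 := Finset.sum_range_succ (fun i => f (i + k)) n
    have h2 := Finset.sum_range_succ' (fun i => f (i + k)) n
    rw [h1] at h2
    have h3 : f (n + k) = f (0 + k) := by rw [Nat.add_comm n k, hf, Nat.zero_add]
    simp only [h3] at h2
    have h4 := add_right_cancel h2
    rw [h4]
    refine Finset.sum_congr rfl fun i _ => ?_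
    congr 1
    omega

/-- If `n ≥ 2`, `P` is a prime divisor of `n`, `n = P^α m` with `α = v_P(n) ≥ 1` and
`gcd(P,m) = 1`, and `t` is an integer with `P^{α−1} ∤ t`, then `c_n(t) = 0`. -/
theorem stmt14 (n : ℕ) (hn : 2 ≤ n) (P : ℕ) (hP : P.Prime) (hPn : P ∣ n)
    (α : ℕ) (hα : α = n.factorization P) (hα1 : 1 ≤ α)
    (m : ℕ) (hnm : n = P ^ α * m) (hPm : Nat.gcd P m = 1)
    (t : ℤ) (ht : ¬ ((P : ℤ) ^ (α - 1) ∣ t)) :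
    ramanujan n t = 0 := by
  have hn0 : (n : ℂ) ≠ 0 := by
    have : n ≠ 0 := by omega
    exact_mod_cast this
  set f : ℕ → ℂ := fun a => if Nat.gcd a n = 1 then
    Complex.exp (2 * Real.pi * Complex.I * a * t / n) else 0 with hfdef
  have hf : ∀ a, f (a + n) = f a := by
    intro a
    simp only [hfdef, Nat.gcd_add_self_left]
    congr 1
    rw [Complex.exp_eq_exp_iff_exists_int]
    refine ⟨t, ?_⟩
    push_cast
    field_simp
  have hS : ramanujan n t = ∑ i ∈ Finset.range n, f i := by
    rw [ramanujan, Un, Finset.sum_filter, ← shift_sum n f hf 1]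
    have : Finset.Icc 1 n = Finset.Ico 1 (n + 1) := by
      ext; simp only [Finset.mem_Icc, Finset.mem_Ico]; omega
    rw [this, Finset.sum_Ico_eq_sum_range]
    simp only [Nat.add_sub_cancel, hfdef, Nat.add_comm 1]
  set w : ℂ := Complex.exp (2 * Real.pi * Complex.I * ((P * m : ℕ) : ℂ) * t / n) with hw
  have hstep : ∀ a, f (a + P * m) = w * f a := by
    intro a
    have hg : Nat.gcd (a + P * m) n = 1 ↔ Nat.gcd a n = 1 := by
      change Nat.Coprime _ _ ↔ Nat.Coprime _ _
      rw [hnm, Nat.coprime_mul_iff_right, Nat.coprime_mul_iff_right,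
        Nat.coprime_pow_right_iff (by omega), Nat.coprime_pow_right_iff (by omega)]
      simp
    simp only [hfdef, hg]
    split_ifs
    · rw [hw, ← Complex.exp_add]
      congr 1
      push_cast
      ring
    · simp
  have hw1 : w ≠ 1 := by
    intro h
    rw [hw, Complex.exp_eq_one_iff] at h
    obtain ⟨k, hk⟩ := h
    apply ht
    have h2 : (2 * Real.pi * Complex.I : ℂ) ≠ 0 := Complex.two_pi_I_ne_zero
    have h3 : ((P * m : ℕ) : ℂ) * t = k * n := by
      apply mul_left_cancel₀ h2
      rw [div_eq_iff hn0] at hk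
      linear_combination hk
    have h4 : ((P * m : ℕ) : ℤ) * t = k * n := by exact_mod_cast h3
    obtain ⟨b, rfl⟩ : ∃ b, α = b + 1 := ⟨α - 1, by omega⟩
    have hPm0 : ((P * m : ℕ) : ℤ) ≠ 0 := by
      have : P * m ≠ 0 := by
        refine Nat.mul_ne_zero hP.ne_zero ?_
        rintro rfl
        simp at hnm
        omega
      exact_mod_cast this
    refine ⟨k, mul_left_cancel₀ hPm0 ?_⟩
    rw [h4, hnm, Nat.add_sub_cancel]
    push_cast
    ring
  have key := shift_sum n f hf (P * m)
  simp only [hstep, ← Finset.mul_sum] at key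
  rw [hS]
  by_contra hne
  exact hw1 (mul_right_cancel₀ hne (key.trans (one_mul _).symm))
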